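/- TW_k-model property: for every k ≥ 2, if a CPDL⁺(TW_k) formula φ is satisfiable in some Kripke structure (i.e. K,w ⊨ φ for some Kripke structure K and world w), then φ is satisfiable in a countable Kripke structure whose Gaifman graph has tree-width at most k. -/

import Mathlib

namespace PaperCPDL

/-- Relational structures over a fixed countably infinite signature:
for every arity `n` there are countably many relation names, indexed by `ℕ`. -/
structure Struct : Type 1 where
  World : Type
  rel : (n : ℕ) → ℕ → (Fin n → World) → Prop

namespace Struct

variable (K : Struct)

/-- Atomic propositions are the unary relation names. -/
def prop (p : ℕ) (w : K.World) : Prop := K.rel 1 p fun _ => w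

/-- Atomic programs are the binary relation names. -/
def prog (a : ℕ) (u v : K.World) : Prop :=
  K.rel 2 a fun i => if (i : ℕ) = 0 then u else v

/-- A Kripke structure interprets every relation of arity `> 2` as the empty relation. -/
def IsKripke : Prop := ∀ n, 2 < n → ∀ r (t : Fin n → K.World), ¬ K.rel n r t

/-- Gaifman adjacency: `u` and `v` occur together in a tuple of some relation. -/
def gadj (u v : K.World) : Prop :=
  ∃ (n r : ℕ) (t : Fin n → K.World), K.rel n r t ∧ (∃ i, t i = u) ∧ ∃ j, t j = v

/-- distance at most 1 in the Gaifman graph. -/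
def near (u v : K.World) : Prop := u = v ∨ K.gadj u v

/-- same connected component of the Gaifman graph. -/
def sameComp (u v : K.World) : Prop := Relation.ReflTransGen K.gadj u v

/-- finite degree: every world has finitely many Gaifman-neighbours. -/
def FiniteDegree : Prop := ∀ u, {v | K.gadj u v}.Finite

end Struct

/-- r-atoms `R(x₁,…,xₙ)`: a relation name with its argument variables. -/
structure RAtom where
  name : ℕ
  args : List ℕ

mutual
  /-- Formulas of (U)CPDL⁺ (together with `loop` and program intersection,
  used to carve out the various fragments). -/
  inductive Fml : Type where
    | prop : ℕ → Fml
    | neg : Fml → Fml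
    | and : Fml → Fml → Fml
    | diam : Prog → Fml
    | loop : Prog → Fml
  /-- Programs. -/
  inductive Prog : Type where
    | eps : Prog
    | atom : ℕ → Prog
    | conv : ℕ → Prog
    | union : Prog → Prog → Prog
    | comp : Prog → Prog → Prog
    | star : Prog → Prog
    | test : Fml → Prog
    | inter : Prog → Prog → Prog
    | univ : Prog
    | cq : PList → List RAtom → ℕ → ℕ → Prog
  /-- Finite lists of p-atoms `π(x,y)`. -/
  inductive PList : Type where
    | nil : PList
    | cons : Prog → ℕ → ℕ → PList → PList
end

/-- satisfaction of an r-atom under an assignment. -/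
def Struct.ratomSat (K : Struct) (f : ℕ → K.World) (r : RAtom) : Prop :=
  K.rel r.args.length r.name fun i => f (r.args.get i)

mutual
  /-- semantics of formulas. -/
  def evalF (K : Struct) : Fml → K.World → Prop
    | .prop p, w => K.prop p w
    | .neg φ, w => ¬ evalF K φ w
    | .and φ ψ, w => evalF K φ w ∧ evalF K ψ w
    | .diam π, w => ∃ v, evalP K π w v
    | .loop π, w => evalP K π w w
  /-- semantics of programs. -/
  def evalP (K : Struct) : Prog → K.World → K.World → Prop
    | .eps, u, v => u = v
    | .atom a, u, v => K.prog a u v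
    | .conv a, u, v => K.prog a v u
    | .union π₁ π₂, u, v => evalP K π₁ u v ∨ evalP K π₂ u v
    | .comp π₁ π₂, u, v => ∃ w, evalP K π₁ u w ∧ evalP K π₂ w v
    | .star π, u, v => Relation.ReflTransGen (fun a b => evalP K π a b) u v
    | .test φ, u, v => u = v ∧ evalF K φ u
    | .inter π₁ π₂, u, v => evalP K π₁ u v ∧ evalP K π₂ u v
    | .univ, _, _ => True
    | .cq ps rs xs xt, u, v =>
        ∃ f : ℕ → K.World, f xs = u ∧ f xt = v ∧ evalPL K f ps ∧ ∀ r ∈ rs, K.ratomSat f r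
  /-- semantics of a list of p-atoms. -/
  def evalPL (K : Struct) (f : ℕ → K.World) : PList → Prop
    | .nil => True
    | .cons π x y ps => evalP K π (f x) (f y) ∧ evalPL K f ps
end

/-! ## Conjunctive programs: variables, underlying graph, well-formedness -/

/-- variables occurring in a list of p-atoms. -/
def PList.vars : PList → List ℕ
  | .nil => []
  | .cons _ x y ps => x :: y :: ps.vars

/-- variables of a conjunctive program given by p-atoms `ps` and r-atoms `rs`. -/
def cqVars (ps : PList) (rs : List RAtom) : List ℕ :=
  ps.vars ++ (rs.map RAtom.args).flatten

/-- co-occurrence of two variables in a p-atom of the list. -/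
def PList.coOcc (x y : ℕ) : PList → Prop
  | .nil => False
  | .cons _ a b ps => ((x = a ∨ x = b) ∧ (y = a ∨ y = b)) ∨ PList.coOcc x y ps

/-- adjacency in the graph `G_C`: co-occurrence of two variables in some atom. -/
def atomAdj (ps : PList) (rs : List RAtom) (x y : ℕ) : Prop :=
  ps.coOcc x y ∨ ∃ r ∈ rs, x ∈ r.args ∧ y ∈ r.args

/-- adjacency in the underlying graph of `C[x_s,x_t]`: `G_C` plus the edge `{x_s,x_t}`. -/
def ugAdj (ps : PList) (rs : List RAtom) (xs xt : ℕ) (x y : ℕ) : Prop :=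
  atomAdj ps rs x y ∨ (x = xs ∧ y = xt) ∨ (x = xt ∧ y = xs)

/-- base well-formedness of a conjunctive program `C[x_s,x_t]`:
`x_s,x_t ∈ Vars(C)`, every r-atom has arity `> 2`, and `G_C` is connected. -/
def cqWF (ps : PList) (rs : List RAtom) (xs xt : ℕ) : Prop :=
  xs ∈ cqVars ps rs ∧ xt ∈ cqVars ps rs ∧
  (∀ r ∈ rs, 2 < r.args.length) ∧
  ∀ x ∈ cqVars ps rs, ∀ y ∈ cqVars ps rs, Relation.ReflTransGen (atomAdj ps rs) x y

/-! ## Tree decompositions and tree-width -/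

/-- A tree decomposition of the graph with vertex set `V` and adjacency `adj`. -/
structure TreeDecomp {α : Type} (V : Set α) (adj : α → α → Prop) where
  /-- the nodes of the tree -/
  B : Type
  /-- the tree -/
  tree : SimpleGraph B
  isTree : tree.IsTree
  /-- the bags -/
  bag : B → Set α
  cover_vert : ∀ v ∈ V, ∃ b, v ∈ bag b
  cover_edge : ∀ u v, adj u v → ∃ b, u ∈ bag b ∧ v ∈ bag b
  bags_conn : ∀ (v : α) (b₁ b₂ : B), v ∈ bag b₁ → v ∈ bag b₂ →
      ∃ p : tree.Walk b₁ b₂, ∀ x ∈ p.support, v ∈ bag x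

/-- the width of a tree decomposition is at most `k`. -/
def TreeDecomp.WidthLE {α : Type} {V : Set α} {adj : α → α → Prop}
    (td : TreeDecomp V adj) (k : ℕ) : Prop :=
  ∀ b, (td.bag b).Finite ∧ (td.bag b).ncard ≤ k + 1

/-- the graph `(V, adj)` has tree-width at most `k`. -/
def TreewidthLE {α : Type} (V : Set α) (adj : α → α → Prop) (k : ℕ) : Prop :=
  ∃ td : TreeDecomp V adj, td.WidthLE k

/-- the Gaifman graph of the structure `K` has tree-width at most `k`. -/
def Struct.twLE (K : Struct) (k : ℕ) : Prop :=
  TreewidthLE (Set.univ : Set K.World) K.gadj k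

/-- A good tree decomposition: along every tree edge one bag contains the other,
and the tree is binary (it has a root of degree `≤ 2`, all other nodes have degree `≤ 3`). -/
def TreeDecomp.Good {α : Type} {V : Set α} {adj : α → α → Prop} (td : TreeDecomp V adj) : Prop :=
  (∀ b b', td.tree.Adj b b' → td.bag b ⊆ td.bag b' ∨ td.bag b' ⊆ td.bag b) ∧
  ∃ r : td.B, ∀ b, {b' | td.tree.Adj b b'}.Finite ∧
    ((b = r → {b' | td.tree.Adj b b'}.ncard ≤ 2) ∧ (b ≠ r → {b' | td.tree.Adj b b'}.ncard ≤ 3))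

/-! ## Fragments -/

/-- all p-atoms of the list are of the form `π(x,x)` for the fixed variable `x`. -/
def PList.allOn (x : ℕ) : PList → Prop
  | .nil => True
  | .cons _ a b ps => a = x ∧ b = x ∧ PList.allOn x ps

/-- A fragment specification: which of `loop`, `∩`, `U` are allowed, and which
shapes of conjunctive programs are allowed. -/
structure Frag where
  loopOK : Prop
  interOK : Prop
  univOK : Prop
  cqOK : PList → List RAtom → ℕ → ℕ → Prop

mutual
  /-- the formula belongs to the fragment `F`. -/
  def Fml.In : Frag → Fml → Prop
    | _, .prop _ => True
    | F, .neg φ => Fml.In F φ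
    | F, .and φ ψ => Fml.In F φ ∧ Fml.In F ψ
    | F, .diam π => Prog.In F π
    | F, .loop π => F.loopOK ∧ Prog.In F π
  /-- the program belongs to the fragment `F`. -/
  def Prog.In : Frag → Prog → Prop
    | _, .eps => True
    | _, .atom _ => True
    | _, .conv _ => True
    | F, .union π₁ π₂ => Prog.In F π₁ ∧ Prog.In F π₂
    | F, .comp π₁ π₂ => Prog.In F π₁ ∧ Prog.In F π₂
    | F, .star π => Prog.In F π
    | F, .test φ => Fml.In F φ
    | F, .inter π₁ π₂ => F.interOK ∧ Prog.In F π₁ ∧ Prog.In F π₂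
    | F, .univ => F.univOK
    | F, .cq ps rs xs xt => F.cqOK ps rs xs xt ∧ cqWF ps rs xs xt ∧ PList.In F ps
  /-- all programs of the list belong to the fragment `F`. -/
  def PList.In : Frag → PList → Prop
    | _, .nil => True
    | F, .cons π _ _ ps => Prog.In F π ∧ PList.In F ps
end

/-- CPDL: PDL with converse. -/
def Frag.cpdl : Frag := ⟨False, False, False, fun _ _ _ _ => False⟩
/-- ICPDL: CPDL with program intersection. -/
def Frag.icpdl : Frag := ⟨False, True, False, fun _ _ _ _ => False⟩
/-- loop-CPDL: CPDL with `loop(π)` formulas. -/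
def Frag.loopCpdl : Frag := ⟨True, False, False, fun _ _ _ _ => False⟩
/-- CPDL⁺: CPDL with conjunctive programs. -/
def Frag.cpdlPlus : Frag := ⟨False, False, False, fun _ _ _ _ => True⟩
/-- UCPDL⁺: CPDL⁺ with the universal program. -/
def Frag.ucpdlPlus : Frag := ⟨False, False, True, fun _ _ _ _ => True⟩
/-- CPDL⁺(TW_k): conjunctive programs with underlying graph of tree-width `≤ k`. -/
def Frag.tw (k : ℕ) : Frag :=
  ⟨False, False, False, fun ps rs xs xt =>
    TreewidthLE {x | x ∈ cqVars ps rs} (ugAdj ps rs xs xt) k⟩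
/-- UCPDL⁺(TW_k). -/
def Frag.utw (k : ℕ) : Frag :=
  ⟨False, False, True, fun ps rs xs xt =>
    TreewidthLE {x | x ∈ cqVars ps rs} (ugAdj ps rs xs xt) k⟩
/-- CPDL⁺(𝒢↺): the only conjunctive programs are `C[x,x]` where all atoms
are p-atoms of the form `π(x,x)`. -/
def Frag.gloop : Frag :=
  ⟨False, False, False, fun ps rs xs xt => xt = xs ∧ rs = [] ∧ PList.allOn xs ps⟩
/-- ICPDL⁺(TW₂): CPDL⁺(TW₂) together with program intersection. -/
def Frag.icpdlPlusTw2 : Frag :=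
  ⟨False, True, False, fun ps rs xs xt =>
    TreewidthLE {x | x ∈ cqVars ps rs} (ugAdj ps rs xs xt) 2⟩

mutual
  /-- positive formulas: no occurrence of negation. -/
  def Fml.Positive : Fml → Prop
    | .prop _ => True
    | .neg _ => False
    | .and φ ψ => Fml.Positive φ ∧ Fml.Positive ψ
    | .diam π => Prog.Positive π
    | .loop π => Prog.Positive π
  /-- positive programs. -/
  def Prog.Positive : Prog → Prop
    | .eps => True
    | .atom _ => True
    | .conv _ => True
    | .union π₁ π₂ => Prog.Positive π₁ ∧ Prog.Positive π₂
    | .comp π₁ π₂ => Prog.Positive π₁ ∧ Prog.Positive π₂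
    | .star π => Prog.Positive π
    | .test φ => Fml.Positive φ
    | .inter π₁ π₂ => Prog.Positive π₁ ∧ Prog.Positive π₂
    | .univ => True
    | .cq ps _ _ _ => PList.Positive ps
  /-- positive p-atom lists. -/
  def PList.Positive : PList → Prop
    | .nil => True
    | .cons π _ _ ps => Prog.Positive π ∧ PList.Positive ps
end

/-! ## Countability of the syntax -/

/-- Numerical code of an r-atom. -/
def RAtom.code (r : RAtom) : ℕ := Encodable.encode (r.name, r.args)

theorem RAtom.code_injective : Function.Injective RAtom.code := by
  rintro ⟨n, l⟩ ⟨n', l'⟩ h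
  simpa [RAtom.code] using h

mutual
  /-- Numerical code of a formula. -/
  def Fml.code : Fml → ℕ
    | .prop p => Nat.pair 0 p
    | .neg φ => Nat.pair 1 φ.code
    | .and φ ψ => Nat.pair 2 (Nat.pair φ.code ψ.code)
    | .diam π => Nat.pair 3 π.code
    | .loop π => Nat.pair 4 π.code
  /-- Numerical code of a program. -/
  def Prog.code : Prog → ℕ
    | .eps => Nat.pair 0 0
    | .atom a => Nat.pair 1 a
    | .conv a => Nat.pair 2 a
    | .union π₁ π₂ => Nat.pair 3 (Nat.pair π₁.code π₂.code)
    | .comp π₁ π₂ => Nat.pair 4 (Nat.pair π₁.code π₂.code)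
    | .star π => Nat.pair 5 π.code
    | .test φ => Nat.pair 6 φ.code
    | .inter π₁ π₂ => Nat.pair 7 (Nat.pair π₁.code π₂.code)
    | .univ => Nat.pair 8 0
    | .cq ps rs xs xt =>
        Nat.pair 9 (Nat.pair ps.code (Encodable.encode (rs.map RAtom.code, xs, xt)))
  /-- Numerical code of a list of p-atoms. -/
  def PList.code : PList → ℕ
    | .nil => Nat.pair 0 0
    | .cons π x y ps => Nat.pair 1 (Nat.pair π.code (Nat.pair x (Nat.pair y ps.code)))
end

mutual
  theorem Fml.code_inj : ∀ φ ψ : Fml, φ.code = ψ.code → φ = ψ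
    | .prop _, ψ, h => by
        cases ψ <;> simp_all [Fml.code, Nat.pair_eq_pair]
    | .neg φ, ψ, h => by
        cases ψ <;> simp [Fml.code, Nat.pair_eq_pair] at h ⊢
        exact Fml.code_inj _ _ h
    | .and φ₁ φ₂, ψ, h => by
        cases ψ <;> simp [Fml.code, Nat.pair_eq_pair] at h ⊢
        exact ⟨Fml.code_inj _ _ h.1, Fml.code_inj _ _ h.2⟩
    | .diam π, ψ, h => by
        cases ψ <;> simp [Fml.code, Nat.pair_eq_pair] at h ⊢
        exact Prog.code_inj _ _ h
    | .loop π, ψ, h => by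
        cases ψ <;> simp [Fml.code, Nat.pair_eq_pair] at h ⊢
        exact Prog.code_inj _ _ h
  theorem Prog.code_inj : ∀ π ρ : Prog, π.code = ρ.code → π = ρ
    | .eps, ρ, h => by
        cases ρ <;> simp_all [Prog.code, Nat.pair_eq_pair]
    | .atom _, ρ, h => by
        cases ρ <;> simp_all [Prog.code, Nat.pair_eq_pair]
    | .conv _, ρ, h => by
        cases ρ <;> simp_all [Prog.code, Nat.pair_eq_pair]
    | .union π₁ π₂, ρ, h => by
        cases ρ <;> simp [Prog.code, Nat.pair_eq_pair] at h ⊢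
        exact ⟨Prog.code_inj _ _ h.1, Prog.code_inj _ _ h.2⟩
    | .comp π₁ π₂, ρ, h => by
        cases ρ <;> simp [Prog.code, Nat.pair_eq_pair] at h ⊢
        exact ⟨Prog.code_inj _ _ h.1, Prog.code_inj _ _ h.2⟩
    | .star π, ρ, h => by
        cases ρ <;> simp [Prog.code, Nat.pair_eq_pair] at h ⊢
        exact Prog.code_inj _ _ h
    | .test φ, ρ, h => by
        cases ρ <;> simp [Prog.code, Nat.pair_eq_pair] at h ⊢
        exact Fml.code_inj _ _ h
    | .inter π₁ π₂, ρ, h => by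
        cases ρ <;> simp [Prog.code, Nat.pair_eq_pair] at h ⊢
        exact ⟨Prog.code_inj _ _ h.1, Prog.code_inj _ _ h.2⟩
    | .univ, ρ, h => by
        cases ρ <;> simp_all [Prog.code, Nat.pair_eq_pair]
    | .cq ps rs xs xt, ρ, h => by
        cases ρ <;> simp only [Prog.code, Nat.pair_eq_pair, Encodable.encode_inj,
          Prod.mk.injEq, Prog.cq.injEq] at h ⊢ <;> try omega
        exact ⟨PList.code_inj _ _ h.2.1, RAtom.code_injective.list_map h.2.2.1, h.2.2.2⟩
  theorem PList.code_inj : ∀ ps qs : PList, ps.code = qs.code → ps = qs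
    | .nil, qs, h => by
        cases qs <;> simp_all [PList.code, Nat.pair_eq_pair]
    | .cons π x y ps, qs, h => by
        cases qs <;> simp [PList.code, Nat.pair_eq_pair] at h ⊢
        exact ⟨Prog.code_inj _ _ h.1, h.2.1, h.2.2.1, PList.code_inj _ _ h.2.2.2⟩
end

instance : Countable Prog := Function.Injective.countable fun π ρ => Prog.code_inj π ρ

/-! ## Countable sets of worlds closed under witnesses -/

/-- A set containing `w` and closed under countably many countable-valued binary operations
can be chosen countable. -/
theorem exists_countable_closed {ι α : Type} [Countable ι] (G : ι → α → α → Set α)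
    (hG : ∀ i u v, (G i u v).Countable) (w : α) :
    ∃ S : Set α, S.Countable ∧ w ∈ S ∧ ∀ i, ∀ u ∈ S, ∀ v ∈ S, G i u v ⊆ S := by
  let step : Set α → Set α := fun S => S ∪ ⋃ i, ⋃ u ∈ S, ⋃ v ∈ S, G i u v
  have hstep : ∀ S, S.Countable → (step S).Countable := fun S hS =>
    hS.union <| Set.countable_iUnion fun i => hS.biUnion fun u _ => hS.biUnion fun v _ => hG i u v
  let T : ℕ → Set α := fun n => step^[n] {w}
  have hsucc : ∀ n, T (n + 1) = step (T n) := fun n => Function.iterate_succ_apply' _ _ _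
  have hmono : Monotone T := monotone_nat_of_le_succ fun n => by
    rw [hsucc]
    exact Set.subset_union_left
  have hcount : ∀ n, (T n).Countable := by
    intro n
    induction n with
    | zero => exact Set.countable_singleton w
    | succ n ih => rw [hsucc]; exact hstep _ ih
  refine ⟨⋃ n, T n, Set.countable_iUnion hcount, Set.mem_iUnion.2 ⟨0, rfl⟩, ?_⟩
  intro i u hu v hv x hx
  obtain ⟨m, hm⟩ := Set.mem_iUnion.1 hu
  obtain ⟨n, hn⟩ := Set.mem_iUnion.1 hv
  refine Set.mem_iUnion.2 ⟨max m n + 1, ?_⟩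
  rw [hsucc]
  refine Or.inr (Set.mem_iUnion.2 ⟨i, Set.mem_iUnion₂.2 ⟨u, hmono (le_max_left m n) hm, ?_⟩⟩)
  exact Set.mem_iUnion₂.2 ⟨v, hmono (le_max_right m n) hn, hx⟩

/-- A chain of a reflexive transitive closure stays inside some countable set. -/
theorem exists_countable_reflTransGen {α : Type} {r : α → α → Prop} {u v : α}
    (h : Relation.ReflTransGen r u v) :
    ∃ W : Set α, W.Countable ∧ ∀ S : Set α, W ⊆ S → ∀ (hu : u ∈ S) (hv : v ∈ S),
      Relation.ReflTransGen (fun a b : S => r a b) ⟨u, hu⟩ ⟨v, hv⟩ := by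
  induction h with
  | refl => exact ⟨∅, Set.countable_empty, fun S _ _ _ => .refl⟩
  | @tail b c _ hbc ih =>
    obtain ⟨W, hW, hWS⟩ := ih
    refine ⟨insert b W, hW.insert b, fun S hS hu hv => ?_⟩
    exact (hWS S ((Set.subset_insert _ _).trans hS) hu (hS (Set.mem_insert _ _))).tail hbc

/-- The witnesses needed to reconstruct the pair `(u, v)` of the program `π`
can be found inside the set `S`. -/
def HasWitness (K : Struct) (S : Set K.World) (π : Prog) (u v : S) : Prop :=
  ((∃ w, evalP K π u w) → ∃ w : S, evalP K π u w) ∧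
  match π with
  | .comp π₁ π₂ => evalP K (.comp π₁ π₂) u v → ∃ w : S, evalP K π₁ u w ∧ evalP K π₂ w v
  | .star ρ => evalP K (.star ρ) u v → Relation.ReflTransGen (fun a b : S => evalP K ρ a b) u v
  | .cq ps rs xs xt => evalP K (.cq ps rs xs xt) u v →
      ∃ f : ℕ → S, f xs = u ∧ f xt = v ∧ evalPL K (fun n => f n) ps ∧
        ∀ r ∈ rs, K.ratomSat (fun n => f n) r
  | _ => True

theorem exists_countable_hasWitness (K : Struct) (π : Prog) (u v : K.World) :
    ∃ W : Set K.World, W.Countable ∧ ∀ S : Set K.World, W ⊆ S → ∀ (hu : u ∈ S) (hv : v ∈ S),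
      HasWitness K S π ⟨u, hu⟩ ⟨v, hv⟩ := by
  have hdiam : ∃ W : Set K.World, W.Countable ∧ ∀ S : Set K.World, W ⊆ S →
      (∃ w, evalP K π u w) → ∃ w : S, evalP K π u w := by
    by_cases h : ∃ w, evalP K π u w
    · obtain ⟨w, hw⟩ := h
      exact ⟨{w}, Set.countable_singleton w, fun S hS _ => ⟨⟨w, hS rfl⟩, hw⟩⟩
    · exact ⟨∅, Set.countable_empty, fun _ _ h' => absurd h' h⟩
  obtain ⟨D, hD, hDS⟩ := hdiam
  by_cases h : evalP K π u v
  swap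
  · refine ⟨D, hD, fun S hS hu hv => ⟨hDS S hS, ?_⟩⟩
    split <;> first | trivial | exact fun h' => absurd h' h
  cases π with
  | comp π₁ π₂ =>
    obtain ⟨w, hw⟩ := h
    exact ⟨insert w D, hD.insert w, fun S hS hu hv =>
      ⟨hDS S ((Set.subset_insert _ _).trans hS), fun _ => ⟨⟨w, hS (Set.mem_insert _ _)⟩, hw⟩⟩⟩
  | star ρ =>
    obtain ⟨W, hW, hWS⟩ := exists_countable_reflTransGen h
    exact ⟨D ∪ W, hD.union hW, fun S hS hu hv =>
      ⟨hDS S (Set.subset_union_left.trans hS),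
        fun _ => hWS S (Set.subset_union_right.trans hS) hu hv⟩⟩
  | cq ps rs xs xt =>
    obtain ⟨f, hs, ht, hps, hrs⟩ := h
    refine ⟨D ∪ Set.range f, hD.union (Set.countable_range f), fun S hS hu hv =>
      ⟨hDS S (Set.subset_union_left.trans hS), fun _ => ?_⟩⟩
    exact ⟨fun n => ⟨f n, hS (Or.inr ⟨n, rfl⟩)⟩, Subtype.ext hs, Subtype.ext ht, hps, hrs⟩
  | _ => exact ⟨D, hD, fun S hS hu hv => ⟨hDS S hS, trivial⟩⟩

theorem exists_countable_witnessed (K : Struct) (w : K.World) :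
    ∃ S : Set K.World, S.Countable ∧ w ∈ S ∧ ∀ π (u v : S), HasWitness K S π u v := by
  choose G hG hGS using exists_countable_hasWitness K
  obtain ⟨S, hS, hw, hcl⟩ := exists_countable_closed G hG w
  exact ⟨S, hS, hw, fun π u v => hGS π u v S (hcl π u u.2 v v.2) u.2 v.2⟩

/-! ## The tree of finite sequences -/

/-- The tree of lists: the neighbours of a list are its tail and its extensions by one element. -/
def listTree (L : Type) : SimpleGraph (List L) where
  Adj s t := (∃ B, s = B :: t) ∨ ∃ B, t = B :: s
  symm := ⟨fun _ _ h => h.symm⟩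
  loopless := ⟨fun s h => by
    rcases h with ⟨B, hB⟩ | ⟨B, hB⟩ <;> simpa using congrArg List.length hB⟩

theorem listTree_adj_cons {L : Type} (B : L) (t : List L) : (listTree L).Adj (B :: t) t :=
  Or.inl ⟨B, rfl⟩

theorem listTree_not_reachable_tail {L : Type} (B : L) (t : List L) :
    ¬ ((listTree L).deleteEdges {s(B :: t, t)}).Reachable (B :: t) t := by
  have key : ∀ s s' : List L, ((listTree L).deleteEdges {s(B :: t, t)}).Walk s s' →
      B :: t <:+ s → B :: t <:+ s' := by
    intro s s' p
    induction p with
    | nil => exact id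
    | @cons u v _ hadj _ ih =>
      intro hu
      refine ih ?_
      rw [SimpleGraph.deleteEdges_adj] at hadj
      obtain ⟨⟨C, rfl⟩ | ⟨C, rfl⟩, hne⟩ := hadj
      · rcases List.suffix_cons_iff.1 hu with h | h
        · obtain ⟨rfl, rfl⟩ := List.cons.inj h
          exact absurd rfl hne
        · exact h
      · exact hu.trans (List.suffix_cons C u)
  rintro ⟨p⟩
  simpa using (key _ _ p List.suffix_rfl).length_le

theorem listTree_isTree (L : Type) : (listTree L).IsTree := by
  have hroot : ∀ t : List L, (listTree L).Reachable t [] := by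
    intro t
    induction t with
    | nil => exact .refl _
    | cons B t ih => exact (listTree_adj_cons B t).reachable.trans ih
  refine ⟨⟨fun s t => (hroot s).trans (hroot t).symm⟩, ?_⟩
  rw [SimpleGraph.isAcyclic_iff_forall_adj_isBridge]
  rintro s t (⟨B, rfl⟩ | ⟨B, rfl⟩)
  · exact SimpleGraph.isBridge_iff.2 (listTree_not_reachable_tail B t)
  · rw [Sym2.eq_swap]
    exact SimpleGraph.isBridge_iff.2 (listTree_not_reachable_tail B s)

/-! ## The unravelling -/

/-- Bags: sets of at most `k + 1` elements. -/
abbrev Bag (α : Type) (k : ℕ) : Type := {B : Finset α // B.card ≤ k + 1}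

/-- The last bag of a sequence of bags (the most recent one comes first). -/
def top {α : Type} {k : ℕ} : List (Bag α k) → Finset α
  | [] => ∅
  | B :: _ => B.1

open Classical in
/-- The copy of `u` at the node `t`, represented by the node at which it was introduced. -/
noncomputable def copy {α : Type} {k : ℕ} : List (Bag α k) → α → List (Bag α k) × α
  | [], u => ([], u)
  | B :: t, u => if u ∈ top t then copy t u else (B :: t, u)

theorem copy_cons_of_mem {α : Type} {k : ℕ} (B : Bag α k) {t : List (Bag α k)} {u : α}
    (h : u ∈ top t) : copy (B :: t) u = copy t u := by
  simp [copy, h]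

theorem copy_snd {α : Type} {k : ℕ} (t : List (Bag α k)) (u : α) : (copy t u).2 = u := by
  induction t with
  | nil => rfl
  | cons B t ih =>
    by_cases h : u ∈ top t
    · rw [copy_cons_of_mem B h, ih]
    · simp [copy, h]

/-- The node `t` is joined to the node introducing a copy of `u` by a walk along which
this copy is present. -/
theorem exists_walk_copy {α : Type} {k : ℕ} (t : List (Bag α k)) (u : α) (hu : u ∈ top t) :
    ∃ p : (listTree (Bag α k)).Walk t (copy t u).1,
      ∀ s ∈ p.support, u ∈ top s ∧ copy s u = copy t u := by
  induction t with
  | nil => simp [top] at hu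
  | cons B t ih =>
    by_cases h : u ∈ top t
    · obtain ⟨p, hp⟩ := ih h
      rw [copy_cons_of_mem B h]
      refine ⟨.cons (listTree_adj_cons B t) p, fun s hs => ?_⟩
      rw [SimpleGraph.Walk.support_cons, List.mem_cons] at hs
      rcases hs with rfl | hs
      · exact ⟨hu, copy_cons_of_mem B h⟩
      · exact hp s hs
    · have hc : copy (B :: t) u = (B :: t, u) := by simp [copy, h]
      rw [hc]
      refine ⟨.nil, fun s hs => ?_⟩
      obtain rfl : s = B :: t := by simpa using hs
      exact ⟨hu, hc⟩

/-- The unravelling of `K` along bags of at most `k + 1` worlds from `S`. -/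
noncomputable def unravel (K : Struct) (S : Set K.World) (k : ℕ) : Struct where
  World := {x : List (Bag S k) × S // ∃ t u, u ∈ top t ∧ copy t u = x}
  rel n r τ := ∃ (t : List (Bag S k)) (σ : Fin n → S),
    (∀ i, σ i ∈ top t ∧ copy t (σ i) = (τ i).1) ∧ K.rel n r fun i => σ i

section Unravel

variable {K : Struct} {S : Set K.World} {k : ℕ}

/-- The copy of `u` at the node `t`, as a world of the unravelling. -/
noncomputable def copyAt (t : List (Bag S k)) (u : S) (hu : u ∈ top t) : (unravel K S k).World :=
  ⟨copy t u, t, u, hu, rfl⟩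

/-- The projection of the unravelling onto the original structure. -/
def proj (x : (unravel K S k).World) : K.World := x.1.2

theorem proj_copyAt (t : List (Bag S k)) (u : S) (hu : u ∈ top t) :
    proj (copyAt t u hu) = u :=
  congrArg Subtype.val (copy_snd t u)

theorem exists_copyAt (x : (unravel K S k).World) : ∃ t u hu, x = copyAt t u hu := by
  obtain ⟨x, t, u, hu, rfl⟩ := x
  exact ⟨t, u, hu, rfl⟩

theorem copyAt_cons {B : Bag S k} {t : List (Bag S k)} {u : S} (hB : u ∈ B.1) (hu : u ∈ top t) :
    copyAt (B :: t) u hB = copyAt t u hu :=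
  Subtype.ext (copy_cons_of_mem B hu)

theorem unravel_isKripke (hK : K.IsKripke) : (unravel K S k).IsKripke := by
  rintro n hn r τ ⟨t, σ, -, h⟩
  exact hK n hn r _ h

theorem unravel_countable (hS : S.Countable) : Countable (unravel K S k).World := by
  have : Countable S := hS.to_subtype
  exact Subtype.countable

theorem unravel_twLE : (unravel K S k).twLE k := by
  let bag : List (Bag S k) → Set (unravel K S k).World :=
    fun t => {x | ∃ u, u ∈ top t ∧ copy t u = x.1}
  have hwalk : ∀ x t, x ∈ bag t →
      ∃ p : (listTree (Bag S k)).Walk t x.1.1, ∀ s ∈ p.support, x ∈ bag s := by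
    rintro ⟨x, hx⟩ t ⟨u, hu, rfl⟩
    obtain ⟨p, hp⟩ := exists_walk_copy t u hu
    exact ⟨p, fun s hs => ⟨u, hp s hs⟩⟩
  refine ⟨⟨List (Bag S k), listTree _, listTree_isTree _, bag, ?_, ?_, ?_⟩, ?_⟩
  · rintro ⟨x, t, u, hu⟩ -
    exact ⟨t, u, hu⟩
  · rintro x y ⟨n, r, τ, ⟨t, σ, hσ, -⟩, ⟨i, rfl⟩, ⟨j, rfl⟩⟩
    exact ⟨t, ⟨σ i, hσ i⟩, ⟨σ j, hσ j⟩⟩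
  · intro x s t hs ht
    obtain ⟨p, hp⟩ := hwalk x s hs
    obtain ⟨q, hq⟩ := hwalk x t ht
    refine ⟨p.append q.reverse, fun y hy => ?_⟩
    rw [SimpleGraph.Walk.mem_support_append_iff, SimpleGraph.Walk.support_reverse,
      List.mem_reverse] at hy
    exact hy.elim (hp y) (hq y)
  · intro t
    have hsub : bag t = (fun u : {u // u ∈ top t} => copyAt t u.1 u.2) '' Set.univ := by
      ext x
      constructor
      · rintro ⟨u, hu, hx⟩
        exact ⟨⟨u, hu⟩, trivial, Subtype.ext hx⟩
      · rintro ⟨u, -, rfl⟩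
        exact ⟨u.1, u.2, rfl⟩
    have hcard : (top t).card ≤ k + 1 := by
      cases t with
      | nil => simp [top]
      | cons B t => exact B.2
    change (bag t).Finite ∧ (bag t).ncard ≤ k + 1
    rw [hsub]
    refine ⟨Set.toFinite _, (Set.ncard_image_le Set.finite_univ).trans ?_⟩
    simpa [Set.ncard_univ] using hcard

/-- Every node can be extended by a bag containing any three given worlds. -/
theorem exists_bag_three (hk : 2 ≤ k) (u v w : S) :
    ∃ B : Bag S k, u ∈ B.1 ∧ v ∈ B.1 ∧ w ∈ B.1 := by
  classical
  refine ⟨⟨{u, v, w}, Finset.card_le_three.trans (by omega)⟩, ?_⟩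
  simp

end Unravel

/-! ## Following a tree decomposition -/

/-- Paths towards the root `r`: of two adjacent nodes, one is the parent of the other. -/
theorem exists_rooted_paths {B : Type} {T : SimpleGraph B} (hT : T.IsTree) (r : B) :
    ∃ p : ∀ b, T.Walk b r, p r = .nil ∧
      ∀ a b (h : T.Adj a b), p a = .cons h (p b) ∨ p b = .cons h.symm (p a) := by
  choose p hp hu using fun b => hT.existsUnique_path b r
  refine ⟨p, (hu r _ SimpleGraph.Walk.IsPath.nil).symm, fun a b h => ?_⟩
  by_cases ha : a ∈ (p b).support
  · classical
    right
    have hdrop : (p b).dropUntil a ha = p a := hu a _ ((hp b).dropUntil ha)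
    have htake : (p b).takeUntil a ha = .cons h.symm .nil :=
      (hT.existsUnique_path b a).unique ((hp b).takeUntil ha) (by simp [h.ne'])
    rw [← hdrop]
    conv_lhs => rw [← (p b).take_spec ha, htake]
    rfl
  · exact Or.inl (hu a _ ((hp b).cons ha)).symm

/-- An assignment whose variables have a tree decomposition of width at most `k` lifts to the
unravelling, starting from any node that contains the values of two adjacent variables. -/
theorem exists_lift {K : Struct} {S : Set K.World} {k : ℕ} {V : Set ℕ} {adj : ℕ → ℕ → Prop}
    (htw : TreewidthLE V adj k) (f : ℕ → S) {x₀ y₀ : ℕ} (h₀ : adj x₀ y₀)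
    (t : List (Bag S k)) (hx : f x₀ ∈ top t) (hy : f y₀ ∈ top t) :
    ∃ g : ℕ → (unravel K S k).World,
      g x₀ = copyAt t (f x₀) hx ∧ g y₀ = copyAt t (f y₀) hy ∧
      ∀ x y, adj x y → ∃ s hx' hy', g x = copyAt s (f x) hx' ∧ g y = copyAt s (f y) hy' := by
  classical
  obtain ⟨td, hw⟩ := htw
  let F : td.B → Bag S k := fun b => ⟨(hw b).1.toFinset.image f, by
    refine Finset.card_image_le.trans ?_
    rw [← Set.ncard_eq_toFinset_card _ (hw b).1]
    exact (hw b).2⟩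
  have hF : ∀ b x, x ∈ td.bag b → f x ∈ (F b).1 := fun b x hx =>
    Finset.mem_image_of_mem f ((hw b).1.mem_toFinset.2 hx)
  obtain ⟨r, hxr, hyr⟩ := td.cover_edge _ _ h₀
  obtain ⟨p, hpr, hp⟩ := exists_rooted_paths td.isTree r
  let N : td.B → List (Bag S k) := fun b => (p b).support.map F ++ t
  have hcons : ∀ b, top (N b) = (F b).1 := by
    intro b
    simp only [N]
    rw [← SimpleGraph.Walk.cons_tail_support]
    rfl
  have hN : ∀ b x, x ∈ td.bag b → f x ∈ top (N b) := fun b x hx => by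
    rw [hcons]
    exact hF b x hx
  have hNr : N r = F r :: t := by simp [N, hpr]
  have hstep : ∀ x a b, td.tree.Adj a b → x ∈ td.bag a → x ∈ td.bag b →
      copy (N a) (f x) = copy (N b) (f x) := by
    intro x a b hab ha hb
    rcases hp a b hab with h | h
    · have : N a = F a :: N b := by simp [N, h]
      rw [this, copy_cons_of_mem _ (hN b x hb)]
    · have : N b = F b :: N a := by simp [N, h]
      rw [this, copy_cons_of_mem _ (hN a x ha)]
  have hwalk : ∀ x a b (q : td.tree.Walk a b), (∀ c ∈ q.support, x ∈ td.bag c) →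
      copy (N a) (f x) = copy (N b) (f x) := by
    intro x a b q
    induction q with
    | nil => exact fun _ => rfl
    | @cons a c b hac q ih =>
      intro hq
      rw [hstep x a c hac (hq _ (by simp)) (hq _ (by simp)), ih fun d hd => hq d (by simp [hd])]
  let g : ℕ → (unravel K S k).World := fun x =>
    if h : ∃ b, x ∈ td.bag b then copyAt (N h.choose) (f x) (hN _ x h.choose_spec)
    else copyAt t (f x₀) hx
  have hg : ∀ x b (hb : x ∈ td.bag b), g x = copyAt (N b) (f x) (hN b x hb) := by
    intro x b hb
    have h : ∃ b, x ∈ td.bag b := ⟨b, hb⟩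
    obtain ⟨q, hq⟩ := td.bags_conn x _ _ h.choose_spec hb
    simp only [g, dif_pos h]
    exact Subtype.ext (hwalk x _ _ q hq)
  have hroot : ∀ x, x ∈ td.bag r → ∀ hx' : f x ∈ top t, g x = copyAt t (f x) hx' := by
    intro x hxr hx'
    rw [hg x r hxr]
    refine Subtype.ext ?_
    change copy (N r) (f x) = copy t (f x)
    rw [hNr, copy_cons_of_mem _ hx']
  refine ⟨g, hroot _ hxr hx, hroot _ hyr hy, fun x y hxy => ?_⟩
  obtain ⟨b, hxb, hyb⟩ := td.cover_edge _ _ hxy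
  exact ⟨N b, hN b x hxb, hN b y hyb, hg x b hxb, hg y b hyb⟩

/-! ## The unravelling satisfies the same formulas -/

/-- The program `π` of the unravelling projects to `K`, and `K`-related worlds of a common bag
stay related in the unravelling. -/
def Transfers (K : Struct) (S : Set K.World) (k : ℕ) (π : Prog) : Prop :=
  (∀ x y : (unravel K S k).World,
    evalP (unravel K S k) π x y → evalP K π (proj x) (proj y)) ∧
  ∀ (t : List (Bag S k)) (u v : S) (hu : u ∈ top t) (hv : v ∈ top t),
    evalP K π u v → evalP (unravel K S k) π (copyAt t u hu) (copyAt t v hv)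

theorem prop_unravel {K : Struct} {S : Set K.World} {k : ℕ} (p : ℕ)
    (x : (unravel K S k).World) : (unravel K S k).prop p x ↔ K.prop p (proj x) := by
  constructor
  · rintro ⟨t, σ, hσ, h⟩
    have : (fun i => (σ i : K.World)) = fun _ => proj x := by
      funext i
      rw [proj, ← (hσ i).2, copy_snd]
    rwa [this] at h
  · intro h
    obtain ⟨t, u, hu, rfl⟩ := exists_copyAt x
    rw [proj_copyAt] at h
    exact ⟨t, fun _ => u, fun _ => ⟨hu, rfl⟩, h⟩

theorem proj_prog {K : Struct} {S : Set K.World} {k : ℕ} {a : ℕ}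
    {x y : (unravel K S k).World} (h : (unravel K S k).prog a x y) :
    K.prog a (proj x) (proj y) := by
  obtain ⟨t, σ, hσ, h⟩ := h
  have : (fun i => (σ i : K.World)) = fun i : Fin 2 => if (i : ℕ) = 0 then proj x else proj y := by
    funext i
    rw [← copy_snd t (σ i), (hσ i).2]
    dsimp only
    split <;> rfl
  rwa [this] at h

theorem prog_copyAt {K : Struct} {S : Set K.World} {k : ℕ} {a : ℕ} {t : List (Bag S k)} {u v : S}
    (hu : u ∈ top t) (hv : v ∈ top t) (h : K.prog a u v) :
    (unravel K S k).prog a (copyAt t u hu) (copyAt t v hv) := by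
  refine ⟨t, fun i => if (i : ℕ) = 0 then u else v, fun i => ?_, ?_⟩
  · dsimp only
    split
    exacts [⟨hu, rfl⟩, ⟨hv, rfl⟩]
  · have : (fun i : Fin 2 => ((if (i : ℕ) = 0 then u else v : S) : K.World)) =
        fun i : Fin 2 => if (i : ℕ) = 0 then (u : K.World) else v := by
      funext i
      split <;> rfl
    rw [this]
    exact h

theorem transfers_star {K : Struct} {S : Set K.World} {k : ℕ} (hk : 2 ≤ k) {π : Prog}
    (hS : ∀ u v : S, HasWitness K S (.star π) u v) (hπ : Transfers K S k π) :
    Transfers K S k (.star π) := by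
  refine ⟨fun x y h => Relation.ReflTransGen.lift proj hπ.1 _ _ h, ?_⟩
  intro t u v hu hv h
  have h' := (hS u v).2 h
  clear h
  induction h' using Relation.ReflTransGen.head_induction_on generalizing t with
  | refl => exact Relation.ReflTransGen.refl
  | @head a b hab _ ih =>
    obtain ⟨B, ha, hb, hvB⟩ := exists_bag_three hk a b v
    rw [← copyAt_cons ha hu, ← copyAt_cons hvB hv]
    exact Relation.ReflTransGen.head (hπ.2 (B :: t) a b ha hb hab) (ih (B :: t) hb hvB)

mutual
  theorem evalF_unravel {K : Struct} {S : Set K.World} {k : ℕ} (hk : 2 ≤ k) (hK : K.IsKripke)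
      (hS : ∀ π (u v : S), HasWitness K S π u v) :
      ∀ φ : Fml, φ.In (Frag.tw k) → ∀ x : (unravel K S k).World,
        evalF (unravel K S k) φ x ↔ evalF K φ (proj x)
    | .prop p, _, x => prop_unravel p x
    | .neg φ, h, x => not_congr (evalF_unravel hk hK hS φ h x)
    | .and φ ψ, h, x =>
        and_congr (evalF_unravel hk hK hS φ h.1 x) (evalF_unravel hk hK hS ψ h.2 x)
    | .diam π, h, x => by
        have hπ := transfers_unravel hk hK hS π h
        constructor
        · rintro ⟨y, hy⟩
          exact ⟨proj y, hπ.1 x y hy⟩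
        · intro hx
          obtain ⟨t, u, hu, rfl⟩ := exists_copyAt x
          obtain ⟨v, hv⟩ : ∃ v, evalP K π u v := by rwa [← proj_copyAt t u hu]
          obtain ⟨v, hv⟩ := (hS π u u).1 ⟨v, hv⟩
          obtain ⟨B, huB, hvB, -⟩ := exists_bag_three hk u v v
          refine ⟨copyAt (B :: t) v hvB, ?_⟩
          rw [← copyAt_cons huB hu]
          exact hπ.2 _ _ _ _ _ hv
    | .loop _, h, _ => h.1.elim
  theorem transfers_unravel {K : Struct} {S : Set K.World} {k : ℕ} (hk : 2 ≤ k) (hK : K.IsKripke)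
      (hS : ∀ π (u v : S), HasWitness K S π u v) :
      ∀ π : Prog, π.In (Frag.tw k) → Transfers K S k π
    | .eps, _ => by
        refine ⟨fun x y h => congrArg proj h, fun t u v hu hv h => ?_⟩
        obtain rfl : u = v := Subtype.ext h
        rfl
    | .atom _, _ => ⟨fun _ _ h => proj_prog h, fun _ _ _ hu hv h => prog_copyAt hu hv h⟩
    | .conv _, _ => ⟨fun _ _ h => proj_prog h, fun _ _ _ hu hv h => prog_copyAt hv hu h⟩
    | .union π₁ π₂, h => by
        have h₁ := transfers_unravel hk hK hS π₁ h.1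
        have h₂ := transfers_unravel hk hK hS π₂ h.2
        exact ⟨fun x y => Or.imp (h₁.1 x y) (h₂.1 x y),
          fun t u v hu hv => Or.imp (h₁.2 t u v hu hv) (h₂.2 t u v hu hv)⟩
    | .comp π₁ π₂, h => by
        have h₁ := transfers_unravel hk hK hS π₁ h.1
        have h₂ := transfers_unravel hk hK hS π₂ h.2
        refine ⟨fun x y ⟨z, hz⟩ => ⟨proj z, h₁.1 x z hz.1, h₂.1 z y hz.2⟩, ?_⟩
        intro t u v hu hv huv
        obtain ⟨w, huw, hwv⟩ := (hS (.comp π₁ π₂) u v).2 huv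
        obtain ⟨B, huB, hvB, hwB⟩ := exists_bag_three hk u v w
        rw [← copyAt_cons huB hu, ← copyAt_cons hvB hv]
        exact ⟨copyAt (B :: t) w hwB, h₁.2 _ _ _ _ _ huw, h₂.2 _ _ _ _ _ hwv⟩
    | .star π, h => transfers_star hk (hS _) (transfers_unravel hk hK hS π h)
    | .test φ, h => by
        have hφ := evalF_unravel hk hK hS φ h
        refine ⟨fun x y hxy => ⟨congrArg proj hxy.1, (hφ x).1 hxy.2⟩, ?_⟩
        intro t u v hu hv huv
        obtain rfl : u = v := Subtype.ext huv.1
        exact ⟨rfl, (hφ _).2 (by rw [proj_copyAt]; exact huv.2)⟩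
    | .inter _ _, h => h.1.elim
    | .univ, h => h.elim
    | .cq ps rs xs xt, h => by
        obtain ⟨htw, hwf, hps⟩ := h
        have ih := transfersPL_unravel hk hK hS ps hps
        refine ⟨?_, fun t u v hu hv huv => ?_⟩
        · rintro x y ⟨g, rfl, rfl, hgps, hgrs⟩
          exact ⟨fun n => proj (g n), rfl, rfl, ih.1 g hgps,
            fun r hr => (unravel_isKripke hK _ (hwf.2.2.1 r hr) _ _ (hgrs r hr)).elim⟩
        · obtain ⟨f, rfl, rfl, hfps, hfrs⟩ := (hS (.cq ps rs xs xt) u v).2 huv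
          obtain ⟨g, hgs, hgt, hg⟩ :=
            exists_lift htw f (Or.inr (Or.inl ⟨rfl, rfl⟩)) t hu hv
          exact ⟨g, hgs, hgt, ih.2 f g (fun x y hxy => hg x y (Or.inl (Or.inl hxy))) hfps,
            fun r hr => (hK _ (hwf.2.2.1 r hr) _ _ (hfrs r hr)).elim⟩
  theorem transfersPL_unravel {K : Struct} {S : Set K.World} {k : ℕ} (hk : 2 ≤ k)
      (hK : K.IsKripke) (hS : ∀ π (u v : S), HasWitness K S π u v) :
      ∀ ps : PList, ps.In (Frag.tw k) →
        (∀ g : ℕ → (unravel K S k).World,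
          evalPL (unravel K S k) g ps → evalPL K (fun n => proj (g n)) ps) ∧
        ∀ (f : ℕ → S) (g : ℕ → (unravel K S k).World),
          (∀ x y, ps.coOcc x y →
            ∃ s hx hy, g x = copyAt s (f x) hx ∧ g y = copyAt s (f y) hy) →
          evalPL K (fun n => f n) ps → evalPL (unravel K S k) g ps
    | .nil, _ => ⟨fun _ _ => trivial, fun _ _ _ _ => trivial⟩
    | .cons π x y ps, h => by
        have hπ := transfers_unravel hk hK hS π h.1
        have ih := transfersPL_unravel hk hK hS ps h.2
        refine ⟨fun g hg => ⟨hπ.1 _ _ hg.1, ih.1 g hg.2⟩, fun f g hfg hf => ⟨?_, ?_⟩⟩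
        · obtain ⟨s, hx, hy, hgx, hgy⟩ := hfg x y (Or.inl ⟨Or.inl rfl, Or.inr rfl⟩)
          rw [hgx, hgy]
          exact hπ.2 s _ _ hx hy hf.1
        · exact ih.2 f g (fun x' y' h' => hfg x' y' (Or.inr h')) hf.2
end

/-- TW_k-model property. For every `k ≥ 2`, if a CPDL⁺(TW_k)
formula is satisfiable in some Kripke structure, then it is satisfiable in a
countable Kripke structure whose Gaifman graph has tree-width at most `k`. -/
theorem statement_10 (k : ℕ) (hk : 2 ≤ k) (φ : Fml) (hφ : Fml.In (Frag.tw k) φ)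
    (hsat : ∃ K : Struct, K.IsKripke ∧ ∃ w, evalF K φ w) :
    ∃ K : Struct, K.IsKripke ∧ Countable K.World ∧ K.twLE k ∧ ∃ w, evalF K φ w := by
  obtain ⟨K, hK, w, hw⟩ := hsat
  obtain ⟨S, hS, hwS, hwit⟩ := exists_countable_witnessed K w
  obtain ⟨B, hB, -⟩ : ∃ B : Bag S k, ⟨w, hwS⟩ ∈ top [B] ∧ _ :=
    exists_bag_three hk ⟨w, hwS⟩ ⟨w, hwS⟩ ⟨w, hwS⟩
  refine ⟨unravel K S k, unravel_isKripke hK, unravel_countable hS, unravel_twLE,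
    copyAt [B] ⟨w, hwS⟩ hB, ?_⟩
  rwa [evalF_unravel hk hK hwit φ hφ, proj_copyAt]

end PaperCPDL
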